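/- arXiv:2604.16141 — 5 statements merged into one kernel-verified Lean document; each statement's English description precedes it below -/
import Mathlib

section
/- Let Y be a finite set with |Y| ≥ 2, let X be a finite nonempty set, and let G be a group acting faithfully and transitively on X with d(G) ≥ 2. Then d(Sym(Y) ≀_X G) = max(2, d(C₂ ≀_X G)), where in both wreath products G acts on the index set X via the given action. -/
/-- minimal number of generators of a group -/
noncomputable def d (G : Type*) [Group G] : ℕ :=
  sInf {n | ∃ S : Finset G, S.card = n ∧ Subgroup.closure (S : Set G) = ⊤}

/-- the coordinate-permuting action of `G` on `X → H`, where `G` acts on `X` via `ρ`. -/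
def wrAction (H : Type*) [Group H] {X G : Type*} [Group G]
    (ρ : G →* Equiv.Perm X) : G →* MulAut (X → H) where
  toFun g :=
    { toFun := fun f x => f ((ρ g)⁻¹ x)
      invFun := fun f x => f (ρ g x)
      left_inv := fun f => funext fun x => by simp
      right_inv := fun f => funext fun x => by simp
      map_mul' := fun f₁ f₂ => rfl }
  map_one' := by ext f x; simp
  map_mul' := fun g₁ g₂ => by ext f x; simp [mul_inv_rev]

/-- The wreath product `H ≀_X G`, where `G` acts on `X` via `ρ`. -/
abbrev Wr (H : Type*) [Group H] {X G : Type*} [Group G] (ρ : G →* Equiv.Perm X) : Type _ :=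
  SemidirectProduct (X → H) G (wrAction H ρ)

/-- `C₂`, the cyclic group of order 2. -/
abbrev C2 : Type := Multiplicative (ZMod 2)

open Equiv.Perm in
/-- A normal subgroup of a finite symmetric group that contains an odd permutation is everything. -/
theorem Equiv.Perm.eq_top_of_normal_of_odd {Y : Type*} [Fintype Y] [DecidableEq Y]
    (N : Subgroup (Equiv.Perm Y)) [N.Normal] {σ : Equiv.Perm Y} (hσ : σ ∈ N)
    (hodd : sign σ = -1) : N = ⊤ := by
  have of_alternating (h : alternatingGroup Y ≤ N) : N = ⊤ := by
    refine (Subgroup.eq_top_iff' N).2 fun τ => ?_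
    rcases Int.units_eq_one_or (sign τ) with hτ | hτ
    · exact h (mem_alternatingGroup.2 hτ)
    · have : τ * σ ∈ N := h (mem_alternatingGroup.2 (by simp [hτ, hodd]))
      exact (Subgroup.mul_mem_cancel_right N hσ).1 this
  have of_isConj {α β : Equiv.Perm Y} (hα : α ∈ N) (h : IsConj α β) : β ∈ N := by
    obtain ⟨γ, rfl⟩ := isConj_iff.1 h
    exact ‹N.Normal›.conj_mem α hα γ
  by_cases hY : 5 ≤ Nat.card Y
  · refine of_alternating (alternatingGroup_le_of_normal hY ?_)
    refine (Subgroup.nontrivial_iff_exists_ne_one N).2 ⟨σ, hσ, ?_⟩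
    rintro rfl
    simp at hodd
  · by_cases hinv : σ ^ 2 = 1
    · have hle : σ.support.card ≤ 4 :=
        (Finset.card_le_univ _).trans (by rw [← Nat.card_eq_fintype_card]; omega)
      have hsign := sign_of_pow_two_eq_one hinv
      rw [hodd, card_fixedPoints, sum_cycleType,
        Nat.sub_sub_self (Finset.card_le_univ _)] at hsign
      have hswap : σ.IsSwap := by
        have hdvd := two_dvd_card_support hinv
        refine card_support_eq_two.1 ?_
        generalize σ.support.card = m at *
        interval_cases m
        · simp at hsign
        · omega
        · rfl
        · omega
        · simp at hsign
      rw [eq_top_iff, ← closure_isSwap, Subgroup.closure_le]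
      exact fun τ hτ => of_isConj hσ <| hswap.isCycle.isConj hτ.isCycle <|
        (card_support_eq_two.2 hswap).trans (card_support_eq_two.2 hτ).symm
    · obtain ⟨a, ha⟩ : ∃ a, σ (σ a) ≠ a := by
        by_contra! h
        exact hinv (Equiv.ext fun a => by simpa [pow_two] using h a)
      have ha1 : σ a ≠ a := fun h => ha (by rw [h, h])
      have hmem : Equiv.swap (σ a) (σ (σ a)) * Equiv.swap (σ a) a ∈ N := by
        have h := N.mul_mem hσ (‹N.Normal›.conj_mem _ (N.inv_mem hσ) (Equiv.swap a (σ a)))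
        convert h using 1
        rw [Equiv.swap_apply_apply, Equiv.swap_comm (σ a) a, Equiv.swap_inv]
        simp only [mul_assoc]
      have h3 : IsThreeCycle (Equiv.swap (σ a) (σ (σ a)) * Equiv.swap (σ a) a) :=
        isThreeCycle_swap_mul_swap_same (fun h => ha1 (σ.injective h.symm)) ha1 ha
      refine of_alternating ?_
      rw [← closure_three_cycles_eq_alternating, Subgroup.closure_le]
      exact fun τ hτ => of_isConj hmem (isConj_iff_cycleType_eq.2 (h3.trans hτ.symm))

/-- A transposition together with a permutation of either prescribed sign can generate. -/
theorem Equiv.Perm.exists_odd_closure_pair_eq_top {Y : Type*} [Fintype Y] [DecidableEq Y]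
    (hY : 2 ≤ Fintype.card Y) :
    ∃ a : Equiv.Perm Y, sign a = -1 ∧
      ∀ ε : ℤˣ, ∃ b, sign b = ε ∧ Subgroup.closure {a, b} = ⊤ := by
  obtain ⟨c, hc, -⟩ := (Finset.univ : Finset Y).exists_cycleOn
  have : Nontrivial Y := Fintype.one_lt_card_iff_nontrivial.1 hY
  obtain ⟨x⟩ := (inferInstance : Nonempty Y)
  have hne (y : Y) : c y ≠ y := hc.apply_ne (by simpa using Set.nontrivial_univ) (by simp)
  have hcycle : c.IsCycle := ⟨x, hne x, fun y _ => hc.2 (by simp) (by simp)⟩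
  have hgen := closure_cycle_adjacent_swap hcycle (by ext y; simpa using hne y) x
  refine ⟨Equiv.swap x (c x), sign_swap (hne x).symm, fun ε => ?_⟩
  by_cases hε : sign c = ε
  · exact ⟨c, hε, by rwa [Set.pair_comm]⟩
  · refine ⟨Equiv.swap x (c x) * c, ?_, ?_⟩
    · rw [sign_mul, sign_swap (hne x).symm, neg_one_mul, Int.units_ne_iff_eq_neg.1 hε, neg_neg]
    · rw [eq_top_iff, ← hgen, Subgroup.closure_le]
      have h1 := Subgroup.subset_closure
        (Set.mem_insert (Equiv.swap x (c x)) {Equiv.swap x (c x) * c})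
      have h2 := Subgroup.subset_closure
        (Set.mem_insert_of_mem (Equiv.swap x (c x)) (Set.mem_singleton (Equiv.swap x (c x) * c)))
      rintro τ (rfl | rfl)
      · exact (Subgroup.mul_mem_cancel_left _ h1).1 h2
      · exact h1

theorem d_le_card {G : Type*} [Group G] (T : Finset G)
    (hT : Subgroup.closure (T : Set G) = ⊤) : d G ≤ T.card :=
  Nat.sInf_le ⟨T, rfl, hT⟩

theorem exists_card_eq_d (G : Type*) [Group G] [Finite G] :
    ∃ T : Finset G, T.card = d G ∧ Subgroup.closure (T : Set G) = ⊤ := by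
  have := Fintype.ofFinite G
  have hne : {n | ∃ S : Finset G, S.card = n ∧ Subgroup.closure (S : Set G) = ⊤}.Nonempty :=
    ⟨_, Finset.univ, rfl, by simp⟩
  exact Nat.sInf_mem hne

theorem d_le_of_surjective {G H : Type*} [Group G] [Group H] [Finite G] (f : G →* H)
    (hf : Function.Surjective f) : d H ≤ d G := by
  classical
  obtain ⟨T, hcard, hT⟩ := exists_card_eq_d G
  rw [← hcard]
  refine (d_le_card (T.image f) ?_).trans Finset.card_image_le
  rw [Finset.coe_image, ← MonoidHom.map_closure, hT, Subgroup.map_top_of_surjective f hf]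

/-- A subgroup of a direct power of `S` which is onto in every coordinate, and onto modulo the
kernel of `χ`, is everything, provided `S` is its only normal subgroup not inside `ker χ`. -/
theorem eq_top_of_eval_surjective_of_map_surjective {S A X : Type*} [Group S] [CommGroup A]
    [Finite X] (χ : S →* A) {a : S} (ha : χ a ≠ 1)
    (hnormal : ∀ N : Subgroup S, N.Normal → (∃ s ∈ N, χ s ≠ 1) → N = ⊤)
    (B : Subgroup (X → S)) (heval : ∀ x s, ∃ b ∈ B, b x = s)
    (hχ : ∀ ε : X → S, ∃ b ∈ B, ∀ x, χ (b x) = χ (ε x)) : B = ⊤ := by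
  classical
  have := Fintype.ofFinite X
  /- The coordinates in `T` can be cleared without changing the classes of the others. -/
  have exists_cleared (T : Finset X) (ε : X → S) :
      ∃ b ∈ B, (∀ x ∈ T, b x = 1) ∧ ∀ x ∉ T, χ (b x) = χ (ε x) := by
    induction T using Finset.induction_on generalizing ε with
    | empty => simpa using hχ ε
    | insert y T hy ih =>
      let M : Subgroup S :=
        { carrier := {s | ∃ b ∈ B, (∀ x ∈ T, b x = 1) ∧ (∀ x ≠ y, χ (b x) = 1) ∧ b y = s}
          one_mem' := ⟨1, B.one_mem, by simp⟩
          mul_mem' := by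
            rintro _ _ ⟨b, hb, h1, h2, rfl⟩ ⟨c, hc, h3, h4, rfl⟩
            exact ⟨b * c, B.mul_mem hb hc, by simp +contextual [h1, h3],
              by simp +contextual [h2, h4], rfl⟩
          inv_mem' := by
            rintro _ ⟨b, hb, h1, h2, rfl⟩
            exact ⟨b⁻¹, B.inv_mem hb, by simp +contextual [h1], by simp +contextual [h2], rfl⟩ }
      have hM : M = ⊤ := by
        refine hnormal M ⟨?_⟩ ?_
        · rintro _ ⟨b, hb, h1, h2, rfl⟩ s
          obtain ⟨c, hc, rfl⟩ := heval y s
          exact ⟨c * b * c⁻¹, B.mul_mem (B.mul_mem hc hb) (B.inv_mem hc),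
            by simp +contextual [h1], by simp +contextual [h2], rfl⟩
        · obtain ⟨b, hb, h1, h2⟩ := ih (Pi.mulSingle y a)
          refine ⟨b y, ⟨b, hb, h1, fun x hx => ?_, rfl⟩, by simpa [h2 y hy] using ha⟩
          by_cases hxT : x ∈ T
          · simp [h1 x hxT]
          · simp [h2 x hxT, hx]
      obtain ⟨b, hb, h1, h2⟩ := ih ε
      obtain ⟨c, hc, h3, h4, h5⟩ : b y ∈ M := hM ▸ Subgroup.mem_top _
      refine ⟨b * c⁻¹, B.mul_mem hb (B.inv_mem hc), fun x hx => ?_, fun x hx => ?_⟩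
      · rcases Finset.mem_insert.1 hx with rfl | hx
        · simp [h5]
        · simp [h1 x hx, h3 x hx]
      · rw [Finset.mem_insert, not_or] at hx
        simp [h2 x hx.2, h4 x hx.1]
  have single (x : X) : B.comap (MonoidHom.mulSingle (fun _ => S) x) = ⊤ := by
    refine hnormal _ ⟨fun s hs t => ?_⟩ ?_
    · obtain ⟨b, hb, rfl⟩ := heval x t
      have := B.mul_mem (B.mul_mem hb hs) (B.inv_mem hb)
      rw [Subgroup.mem_comap]
      convert this using 1
      ext y
      by_cases hy : y = x
      · subst hy; simp
      · simp [hy]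
    · obtain ⟨b, hb, h1, h2⟩ := exists_cleared (Finset.univ.erase x) fun _ => a
      refine ⟨b x, ?_, by simpa [h2 x] using ha⟩
      rw [Subgroup.mem_comap]
      convert hb using 1
      ext y
      by_cases hy : y = x
      · subst hy; simp
      · simp [hy, h1 y]
  refine (Subgroup.eq_top_iff' B).2 fun f => Subgroup.pi_mem_of_mulSingle_mem f fun x => ?_
  have : f x ∈ B.comap (MonoidHom.mulSingle (fun _ => S) x) := single x ▸ Subgroup.mem_top _
  exact this

section Wr

variable {S A X G : Type*} [Group S] [CommGroup A] [Group G]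

/-- The homomorphism of wreath products induced by a homomorphism of the base groups. -/
def wrMap (χ : S →* A) (ρ : G →* Equiv.Perm X) : Wr S ρ →* Wr A ρ :=
  SemidirectProduct.map (χ.compLeft X) (MonoidHom.id G) fun _ => rfl

theorem wrMap_left (χ : S →* A) (ρ : G →* Equiv.Perm X) (w : Wr S ρ) (x : X) :
    (wrMap χ ρ w).left x = χ (w.left x) := rfl

theorem wrMap_right (χ : S →* A) (ρ : G →* Equiv.Perm X) (w : Wr S ρ) :
    (wrMap χ ρ w).right = w.right := rfl

theorem wrMap_surjective {χ : S →* A} (hχ : Function.Surjective χ) (ρ : G →* Equiv.Perm X) :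
    Function.Surjective (wrMap χ ρ) := fun t => by
  choose s hs using hχ
  exact ⟨⟨fun x => s (t.left x), t.right⟩, SemidirectProduct.ext (funext fun x => hs _) rfl⟩

theorem wr_mul_left (ρ : G →* Equiv.Perm X) (v w : Wr S ρ) (x : X) :
    (v * w).left x = v.left x * w.left ((ρ v.right)⁻¹ x) := rfl

theorem wr_inv_left (ρ : G →* Equiv.Perm X) (w : Wr S ρ) (x : X) :
    w⁻¹.left x = (w.left (ρ w.right x))⁻¹ := by
  rw [SemidirectProduct.inv_left]
  change (w.left ((ρ w.right⁻¹)⁻¹ x))⁻¹ = _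
  simp

theorem wr_pow_right (ρ : G →* Equiv.Perm X) (w : Wr S ρ) (n : ℕ) :
    (w ^ n).right = w.right ^ n :=
  map_pow (SemidirectProduct.rightHom : Wr S ρ →* G) w n

theorem wr_pow_left (ρ : G →* Equiv.Perm X) (t : Wr A ρ) (n : ℕ) (x : X) :
    (t ^ n).left x = ∏ i ∈ Finset.range n, t.left ((⇑(ρ t.right)⁻¹)^[i] x) := by
  induction n with
  | zero => rfl
  | succ n ih =>
    rw [pow_succ, wr_mul_left, ih, Finset.prod_range_succ, wr_pow_right, map_pow, ← inv_pow,
      ← Equiv.Perm.iterate_eq_pow]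

/-- The elements of the base group occurring at `x` in elements of `L` that fix `x`. -/
def localSubgroup (ρ : G →* Equiv.Perm X) (L : Subgroup (Wr S ρ)) (x : X) : Subgroup S where
  carrier := {s | ∃ w ∈ L, ρ w.right x = x ∧ w.left x = s}
  one_mem' := ⟨1, L.one_mem, by simp, rfl⟩
  mul_mem' := by
    rintro _ _ ⟨v, hv, hv1, rfl⟩ ⟨w, hw, hw1, rfl⟩
    refine ⟨v * w, L.mul_mem hv hw, by simp [hv1, hw1], ?_⟩
    rw [wr_mul_left, Equiv.Perm.inv_eq_iff_eq.2 hv1.symm]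
  inv_mem' := by
    rintro _ ⟨w, hw, hw1, rfl⟩
    refine ⟨w⁻¹, L.inv_mem hw, ?_, by rw [wr_inv_left, hw1]⟩
    rw [SemidirectProduct.inv_right, map_inv, Equiv.Perm.inv_eq_iff_eq, hw1]

/-- A subgroup of a wreath product that is onto modulo the kernel of `χ`, and whose local subgroup
at one point is everything, is everything. -/
theorem wr_eq_top_of_localSubgroup_eq_top [Finite X] (ρ : G →* Equiv.Perm X)
    (hρ : ∀ x y, ∃ g, ρ g x = y) (χ : S →* A) {a : S} (ha : χ a ≠ 1)
    (hnormal : ∀ N : Subgroup S, N.Normal → (∃ s ∈ N, χ s ≠ 1) → N = ⊤)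
    (L : Subgroup (Wr S ρ)) (hL : L.map (wrMap χ ρ) = ⊤) {x : X}
    (hx : localSubgroup ρ L x = ⊤) : L = ⊤ := by
  classical
  have lift (f : X → S) (g : G) : ∃ w ∈ L, (∀ y, χ (w.left y) = χ (f y)) ∧ w.right = g := by
    obtain ⟨w, hw, h⟩ : wrMap χ ρ ⟨f, g⟩ ∈ L.map (wrMap χ ρ) := hL ▸ Subgroup.mem_top _
    exact ⟨w, hw, fun y => congrFun (congrArg SemidirectProduct.left h) y,
      congrArg SemidirectProduct.right h⟩
  let B : Subgroup (X → S) := L.comap SemidirectProduct.inl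
  have conj {w : Wr S ρ} (hw : w ∈ L) {b : X → S} (hb : b ∈ B) :
      ∃ c ∈ B, ∀ y, c (ρ w.right y) =
        w.left (ρ w.right y) * b y * (w.left (ρ w.right y))⁻¹ := by
    refine ⟨(w * SemidirectProduct.inl b * w⁻¹).left, ?_, fun y => ?_⟩
    · have h := L.mul_mem (L.mul_mem hw hb) (L.inv_mem hw)
      rw [Subgroup.mem_comap]
      convert h using 1
      ext <;> simp
    · rw [wr_mul_left, wr_mul_left, wr_inv_left]
      simp
  have hBx : B.map (Pi.evalMonoidHom (fun _ => S) x) = ⊤ := by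
    refine hnormal _ ⟨?_⟩ ?_
    · rintro _ ⟨b, hb, rfl⟩ s
      obtain ⟨w, hw, hwx, rfl⟩ : s ∈ localSubgroup ρ L x := hx ▸ Subgroup.mem_top _
      obtain ⟨c, hc, h⟩ := conj hw hb
      exact ⟨c, hc, by simpa [hwx] using h x⟩
    · obtain ⟨w, hw, h, hr⟩ := lift (Pi.mulSingle x a) 1
      refine ⟨w.left x, ⟨w.left, ?_, rfl⟩, by simpa [h] using ha⟩
      change SemidirectProduct.inl w.left ∈ L
      convert hw using 1
      exact SemidirectProduct.ext rfl hr.symm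
  have hB : B = ⊤ := by
    refine eq_top_of_eval_surjective_of_map_surjective χ ha hnormal B (fun y s => ?_) fun ε => ?_
    · obtain ⟨g, rfl⟩ := hρ x y
      obtain ⟨w, hw, -, rfl⟩ := lift 1 g
      obtain ⟨b, hb, hbx⟩ : (w.left (ρ w.right x))⁻¹ * s * w.left (ρ w.right x) ∈
        B.map (Pi.evalMonoidHom (fun _ => S) x) := hBx ▸ Subgroup.mem_top _
      obtain ⟨c, hc, h⟩ := conj hw hb
      refine ⟨c, hc, ?_⟩
      rw [h, show b x = _ from hbx]
      group
    · obtain ⟨w, hw, h, hr⟩ := lift ε 1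
      refine ⟨w.left, ?_, h⟩
      change SemidirectProduct.inl w.left ∈ L
      convert hw using 1
      exact SemidirectProduct.ext rfl hr.symm
  refine (Subgroup.eq_top_iff' L).2 fun v => ?_
  obtain ⟨w, hw, -, hr⟩ := lift 1 v.right
  have hmem : v.left * w.left⁻¹ ∈ B := hB ▸ Subgroup.mem_top _
  convert L.mul_mem hmem hw using 1
  ext <;> simp [hr]

open Function in
/-- A lift of `t` can be chosen with any compatible value at `x` of the first power fixing `x`. -/
theorem exists_wrMap_eq_and_pow_left_eq [Finite X] (ρ : G →* Equiv.Perm X) {χ : S →* A}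
    (hχ : Surjective χ) (t : Wr A ρ) (x : X) (c : S)
    (hc : χ c = (t ^ minimalPeriod (⇑(ρ t.right)⁻¹) x).left x) :
    ∃ w, wrMap χ ρ w = t ∧ ∃ n, ρ (w ^ n).right x = x ∧ (w ^ n).left x = c := by
  classical
  obtain ⟨v, rfl⟩ := wrMap_surjective hχ ρ t
  rw [wrMap_right] at hc
  set n := minimalPeriod (⇑(ρ v.right)⁻¹) x with hn
  have hper : x ∈ periodicPts (⇑(ρ v.right)⁻¹) :=
    (Equiv.injective _).mem_periodicPts x
  have hnpos : 0 < n := minimalPeriod_pos_of_mem_periodicPts hper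
  let s : S := c * ((v ^ n).left x)⁻¹
  obtain ⟨w, hwr, hwl⟩ : ∃ w : Wr S ρ, w.right = v.right ∧
      ∀ y, w.left y = (Pi.mulSingle x s : X → S) y * v.left y :=
    ⟨⟨Pi.mulSingle x s * v.left, v.right⟩, rfl, fun _ => rfl⟩
  have key (j : ℕ) (hj : j < n) : (w ^ (j + 1)).left x = s * (v ^ (j + 1)).left x := by
    induction j with
    | zero => simp [hwl]
    | succ j ih =>
      have hne : (ρ (v ^ (j + 1)).right)⁻¹ x ≠ x := by
        rw [wr_pow_right, map_pow, ← inv_pow, ← Equiv.Perm.iterate_eq_pow]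
        exact not_isPeriodicPt_of_pos_of_lt_minimalPeriod j.succ_ne_zero hj
      have hr : (w ^ (j + 1)).right = (v ^ (j + 1)).right := by
        rw [wr_pow_right, wr_pow_right, hwr]
      rw [pow_succ w, pow_succ v, wr_mul_left, wr_mul_left, ih (by omega), hr, hwl,
        Pi.mulSingle_eq_of_ne hne, one_mul, mul_assoc]
  have hs : χ s = 1 := by
    rw [map_mul, map_inv, hc, ← map_pow, wrMap_left, mul_inv_cancel]
  refine ⟨w, ?_, n, ?_, ?_⟩
  · refine SemidirectProduct.ext (funext fun y => ?_) hwr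
    rw [wrMap_left, wrMap_left, hwl]
    by_cases hy : y = x
    · subst hy; simp [hs]
    · simp [hy]
  · rw [wr_pow_right, hwr, map_pow]
    have h := iterate_minimalPeriod (f := ⇑(ρ v.right)⁻¹) (x := x)
    rw [← hn, Equiv.Perm.iterate_eq_pow, inv_pow, Equiv.Perm.inv_eq_iff_eq] at h
    exact h.symm
  · obtain ⟨m, hm⟩ := Nat.exists_eq_succ_of_ne_zero hnpos.ne'
    have h := key m (by omega)
    rw [← Nat.succ_eq_add_one, ← hm] at h
    rw [h]
    exact inv_mul_cancel_right _ _

open Function in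
/-- If the product of all coordinates of `t` is nontrivial, so is the product over some cycle. -/
theorem exists_pow_minimalPeriod_left_ne_one [Fintype X] (ρ : G →* Equiv.Perm X) (t : Wr A ρ)
    (ht : ∏ x, t.left x ≠ 1) :
    ∃ x, (t ^ minimalPeriod (⇑(ρ t.right)⁻¹) x).left x ≠ 1 := by
  classical
  set p : Equiv.Perm X := (ρ t.right)⁻¹
  rw [← Finset.prod_fiberwise Finset.univ (Quotient.mk (Equiv.Perm.SameCycle.setoid p))] at ht
  obtain ⟨o, -, ho⟩ := Finset.exists_ne_one_of_prod_ne_one ht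
  induction o using Quotient.inductionOn with | h x => ?_
  refine ⟨x, ?_⟩
  have hper : x ∈ periodicPts p := p.injective.mem_periodicPts x
  have hfib : (Finset.univ.filter fun y => Quotient.mk (Equiv.Perm.SameCycle.setoid p) y = ⟦x⟧) =
      (Finset.range (minimalPeriod p x)).image fun i => p^[i] x := by
    ext y
    simp only [Finset.mem_filter, Finset.mem_univ, true_and, Finset.mem_image, Finset.mem_range]
    rw [Quotient.eq]
    change p.SameCycle y x ↔ _
    rw [Equiv.Perm.sameCycle_comm]
    constructor
    · intro h
      obtain ⟨i, hi⟩ := h.exists_nat_pow_eq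
      refine ⟨i % minimalPeriod p x,
        Nat.mod_lt _ (minimalPeriod_pos_of_mem_periodicPts hper), ?_⟩
      rw [iterate_mod_minimalPeriod_eq, Equiv.Perm.iterate_eq_pow, hi]
    · rintro ⟨i, -, rfl⟩
      exact ⟨i, by rw [zpow_natCast, Equiv.Perm.iterate_eq_pow]⟩
  rw [hfib, Finset.prod_image] at ho
  · rwa [wr_pow_left]
  · intro i hi j hj h
    exact iterate_injOn_Iio_minimalPeriod (by simpa using hi) (by simpa using hj) h

open Function in
/-- Generating sets with at least two elements lift from `A ≀_X G` to `S ≀_X G` when suitable pairs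
of elements of `A` lift to generating pairs of `S`. -/
theorem d_wr_le [Fintype X] [Nonempty X] [Nontrivial A] [Finite A] [Finite G]
    (ρ : G →* Equiv.Perm X) (hρ : ∀ x y, ∃ g, ρ g x = y) {χ : S →* A} (hχ : Surjective χ)
    (hnormal : ∀ N : Subgroup S, N.Normal → (∃ s ∈ N, χ s ≠ 1) → N = ⊤)
    (hpair : ∀ α β : A, α ≠ 1 → ∃ a b, χ a = α ∧ χ b = β ∧ Subgroup.closure {a, b} = ⊤)
    (hd : 2 ≤ d (Wr A ρ)) : d (Wr S ρ) ≤ d (Wr A ρ) := by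
  classical
  have : Finite (Wr A ρ) := Finite.of_equiv _ SemidirectProduct.equivProd.symm
  obtain ⟨T, hcard, hT⟩ := exists_card_eq_d (Wr A ρ)
  obtain ⟨t₁, ht₁, hprod⟩ : ∃ t ∈ T, ∏ x, t.left x ≠ 1 := by
    by_contra! h
    let total : Wr A ρ →* A :=
      { toFun := fun t => ∏ x, t.left x
        map_one' := by simp
        map_mul' := fun v w => by
          simp only [wr_mul_left, Finset.prod_mul_distrib]
          rw [Equiv.prod_comp (ρ v.right)⁻¹ w.left] }
    obtain ⟨α, hα⟩ := exists_ne (1 : A)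
    obtain ⟨x⟩ := ‹Nonempty X›
    have hle : Subgroup.closure (T : Set (Wr A ρ)) ≤ total.ker :=
      (Subgroup.closure_le _).2 fun t ht => h t ht
    have hmem := hle (hT ▸ Subgroup.mem_top (SemidirectProduct.inl (Pi.mulSingle x α)))
    have : ∏ y, (Pi.mulSingle x α : X → A) y = 1 := hmem
    rw [Fintype.prod_pi_mulSingle'] at this
    exact hα this
  obtain ⟨x, hx⟩ := exists_pow_minimalPeriod_left_ne_one ρ t₁ hprod
  obtain ⟨t₂, ht₂, hne⟩ := Finset.exists_mem_ne (by omega : 1 < T.card) t₁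
  obtain ⟨a, b, ha, hb, hab⟩ :=
    hpair _ ((t₂ ^ minimalPeriod (⇑(ρ t₂.right)⁻¹) x).left x) hx
  obtain ⟨w₁, hw₁, n₁, hfix₁, hval₁⟩ := exists_wrMap_eq_and_pow_left_eq ρ hχ t₁ x a ha
  obtain ⟨w₂, hw₂, n₂, hfix₂, hval₂⟩ := exists_wrMap_eq_and_pow_left_eq ρ hχ t₂ x b hb
  let l : Wr A ρ → Wr S ρ := update (update (surjInv (wrMap_surjective hχ ρ)) t₁ w₁) t₂ w₂
  have hl₁ : l t₁ = w₁ := by simp [l, hne.symm]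
  have hl₂ : l t₂ = w₂ := by simp [l]
  have hl (t : Wr A ρ) : wrMap χ ρ (l t) = t := by
    by_cases h₂ : t = t₂
    · rw [h₂, hl₂, hw₂]
    · by_cases h₁ : t = t₁
      · rw [h₁, hl₁, hw₁]
      · simpa [l, h₁, h₂] using surjInv_eq (wrMap_surjective hχ ρ) t
  rw [← hcard]
  refine (d_le_card (T.image l) ?_).trans Finset.card_image_le
  have hmem {t : Wr A ρ} (ht : t ∈ T) :
      l t ∈ Subgroup.closure ((T.image l : Finset (Wr S ρ)) : Set (Wr S ρ)) :=
    Subgroup.subset_closure (Finset.mem_coe.2 (Finset.mem_image_of_mem l ht))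
  refine wr_eq_top_of_localSubgroup_eq_top ρ hρ χ (a := a) (by rwa [ha]) hnormal _ ?_ (x := x) ?_
  · rw [MonoidHom.map_closure, Finset.coe_image, Set.image_image]
    simpa only [hl, Set.image_id'] using hT
  · rw [eq_top_iff, ← hab, Subgroup.closure_le]
    rintro s (rfl | rfl)
    · exact ⟨_, Subgroup.pow_mem _ (hl₁ ▸ hmem ht₁) n₁, hfix₁, hval₁⟩
    · exact ⟨_, Subgroup.pow_mem _ (hl₂ ▸ hmem ht₂) n₂, hfix₂, hval₂⟩

end Wr

/-- The isomorphism from the units of `ℤ` to `C₂`. -/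
def unitsIntEquivC2 : ℤˣ ≃* C2 where
  toFun u := if u = 1 then 1 else Multiplicative.ofAdd 1
  invFun z := if z = 1 then 1 else -1
  left_inv := by decide
  right_inv := by decide
  map_mul' := by decide

theorem stmt_0 {Y X G : Type*} [Fintype Y] [Fintype X] [Nonempty X] [Group G]
    [MulAction G X] [FaithfulSMul G X] [MulAction.IsPretransitive G X]
    (hY : 2 ≤ Fintype.card Y) (hG : 2 ≤ d G) :
    d (Wr (Equiv.Perm Y) (MulAction.toPermHom G X)) =
      max 2 (d (Wr C2 (MulAction.toPermHom G X))) := by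
  classical
  have : Finite G := Finite.of_injective _ (MulAction.toPerm_injective (α := G) (β := X))
  set ρ := MulAction.toPermHom G X
  have : Finite (Wr C2 ρ) := Finite.of_equiv _ SemidirectProduct.equivProd.symm
  have : Finite (Wr (Equiv.Perm Y) ρ) := Finite.of_equiv _ SemidirectProduct.equivProd.symm
  have h2 : 2 ≤ d (Wr C2 ρ) :=
    hG.trans (d_le_of_surjective _ SemidirectProduct.rightHom_surjective)
  rw [max_eq_right h2]
  obtain ⟨a, ha, hgen⟩ := Equiv.Perm.exists_odd_closure_pair_eq_top hY
  let χ : Equiv.Perm Y →* C2 := unitsIntEquivC2.toMonoidHom.comp Equiv.Perm.sign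
  have hχ_apply (σ : Equiv.Perm Y) : χ σ = unitsIntEquivC2 (Equiv.Perm.sign σ) := rfl
  have hodd {σ : Equiv.Perm Y} (h : Equiv.Perm.sign σ ≠ 1) : Equiv.Perm.sign σ = -1 :=
    (Int.units_eq_one_or _).resolve_left h
  have hχ : Function.Surjective χ := fun z => by
    obtain ⟨b, hb, -⟩ := hgen (unitsIntEquivC2.symm z)
    exact ⟨b, by rw [hχ_apply, hb, MulEquiv.apply_symm_apply]⟩
  refine le_antisymm ?_ (d_le_of_surjective _ (wrMap_surjective hχ ρ))
  refine d_wr_le ρ (fun x y => MulAction.exists_smul_eq G x y) hχ ?_ ?_ h2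
  · rintro N hN ⟨σ, hσ, hs⟩
    exact Equiv.Perm.eq_top_of_normal_of_odd N hσ (hodd fun h => hs (by rw [hχ_apply, h, map_one]))
  · intro α β hα
    obtain ⟨b, hb, hab⟩ := hgen (unitsIntEquivC2.symm β)
    refine ⟨a, b, ?_, by rw [hχ_apply, hb, MulEquiv.apply_symm_apply], hab⟩
    rw [hχ_apply, ha]
    revert α
    decide
end

section
/- Let Y be a finite set with |Y| ≥ 5, let X be a finite nonempty set, and let G be a group acting faithfully and transitively on X with d(G) ≥ 2. In the wreath product W = Sym(Y) ≀_X G, the subgroup B = {(f, 1) : f(x) ∈ Alt(Y) for all x ∈ X} (the direct power of the alternating group Alt(Y) inside the base group) is the unique minimal normal subgroup of W; that is, B is a nontrivial normal subgroup of W and every nontrivial normal subgroup of W contains B. -/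
/-- The symmetric group on at least three points has trivial center. -/
theorem Equiv.Perm.exists_commutator_ne_one {Y : Type*} [Fintype Y] [DecidableEq Y]
    (hY : 3 ≤ Fintype.card Y) {σ : Equiv.Perm Y} (hσ : σ ≠ 1) :
    ∃ τ : Equiv.Perm Y, σ * τ * σ⁻¹ * τ⁻¹ ≠ 1 := by
  obtain ⟨a, ha⟩ : ∃ a, σ a ≠ a := by
    by_contra! h
    exact hσ (Equiv.ext h)
  obtain ⟨c, hc⟩ : ∃ c, c ∉ ({a, σ a} : Finset Y) := by
    by_contra! h
    have h₁ := Finset.card_le_card (fun y _ => h y : Finset.univ ⊆ {a, σ a})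
    have h₂ := Finset.card_le_two (a := a) (b := σ a)
    rw [Finset.card_univ] at h₁
    omega
  simp only [Finset.mem_insert, Finset.mem_singleton, not_or] at hc
  refine ⟨Equiv.swap (σ a) c, fun h => hc.2 ?_⟩
  have h₁ : σ * Equiv.swap (σ a) c = Equiv.swap (σ a) c * σ := by
    rwa [mul_inv_eq_one, mul_inv_eq_iff_eq_mul] at h
  have h₂ := congrArg (fun τ : Equiv.Perm Y => τ a) h₁
  simpa [Equiv.swap_apply_of_ne_of_ne ha.symm (Ne.symm hc.1)] using h₂.symm

/-- A nontrivial normal subgroup of a permutational wreath product with a faithful action meets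
the base group nontrivially. -/
theorem exists_inl_mem_of_normal {H X G : Type*} [Group H] [Nontrivial H] [Group G]
    {ρ : G →* Equiv.Perm X} (hρ : Function.Injective ρ)
    {N : Subgroup (Wr H ρ)} (hN : N.Normal) (hN' : N ≠ ⊥) :
    ∃ f : X → H, f ≠ 1 ∧ (SemidirectProduct.inl f : Wr H ρ) ∈ N := by
  classical
  obtain ⟨n, hn, hn1⟩ := N.bot_or_exists_ne_one.resolve_left hN'
  by_cases hg : n.right = 1
  · have h : n = SemidirectProduct.inl n.left := SemidirectProduct.ext (by simp) (by simp [hg])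
    refine ⟨n.left, fun e => hn1 ?_, h ▸ hn⟩
    rw [h, e, map_one]
  · obtain ⟨x, hx⟩ : ∃ x, (ρ n.right)⁻¹ x ≠ x := by
      by_contra! h
      refine hg (hρ ?_)
      rw [map_one, ← inv_eq_one]
      exact Equiv.ext h
    obtain ⟨h, hh⟩ := exists_ne (1 : H)
    let a : X → H := Pi.mulSingle x h
    refine ⟨n.left * wrAction H ρ n.right a * n.left⁻¹ * a⁻¹, fun e => hh ?_, ?_⟩
    · have h₁ : n.left x * a ((ρ n.right)⁻¹ x) * (n.left x)⁻¹ * (a x)⁻¹ = 1 := congrFun e x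
      have ha : a ((ρ n.right)⁻¹ x) = 1 := Pi.mulSingle_eq_of_ne (M := fun _ => H) hx h
      rw [ha] at h₁
      simpa [a] using h₁
    · have h₁ : n * (SemidirectProduct.inl a * n⁻¹ * (SemidirectProduct.inl a)⁻¹) ∈ N :=
        N.mul_mem hn (hN.conj_mem _ (N.inv_mem hn) _)
      convert h₁ using 1
      ext1 <;> simp [mul_assoc]

theorem inr_mul_inl_mulSingle_mul_inv {H X G : Type*} [DecidableEq X] [Group H] [Group G]
    (ρ : G →* Equiv.Perm X) (g : G) (x : X) (h : H) :
    (SemidirectProduct.inr g * SemidirectProduct.inl (Pi.mulSingle x h) *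
      (SemidirectProduct.inr g)⁻¹ : Wr H ρ) =
      SemidirectProduct.inl (Pi.mulSingle (ρ g x) h) := by
  rw [← map_inv, ← SemidirectProduct.inl_aut]
  congr 1
  ext y
  simp [wrAction, Pi.mulSingle_apply, Equiv.symm_apply_eq]

/-- A nontrivial normal subgroup of a wreath product of `Equiv.Perm Y` by a faithful transitive
action contains the direct power of the alternating group. -/
theorem map_inl_pi_alternatingGroup_le {Y X G : Type*} [Fintype Y] [DecidableEq Y] [Finite X]
    [Group G] [MulAction G X] [FaithfulSMul G X] [MulAction.IsPretransitive G X]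
    (hY : 5 ≤ Fintype.card Y) {N : Subgroup (Wr (Equiv.Perm Y) (MulAction.toPermHom G X))}
    (hN : N.Normal) (hN' : N ≠ ⊥) :
    Subgroup.map SemidirectProduct.inl
      (Subgroup.pi Set.univ fun _ : X => alternatingGroup Y) ≤ N := by
  classical
  have : Nontrivial Y := Fintype.one_lt_card_iff_nontrivial.mp (by omega)
  obtain ⟨f, hf, hfN⟩ := exists_inl_mem_of_normal MulAction.toPerm_injective hN hN'
  obtain ⟨x, hx⟩ := Function.ne_iff.mp hf
  obtain ⟨τ, hτ⟩ := Equiv.Perm.exists_commutator_ne_one (by omega) hx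
  let N₀ : Subgroup (X → Equiv.Perm Y) := N.comap SemidirectProduct.inl
  have hN₀ : N₀.Normal := hN.comap _
  let K : Subgroup (Equiv.Perm Y) := N₀.comap (MonoidHom.mulSingle (fun _ => Equiv.Perm Y) x)
  have hK : K.Normal := hN₀.comap _
  have hmem : f x * τ * (f x)⁻¹ * τ⁻¹ ∈ K := by
    have h₁ : f * (Pi.mulSingle x τ * f⁻¹ * (Pi.mulSingle x τ)⁻¹) ∈ N₀ :=
      N₀.mul_mem hfN (hN₀.conj_mem _ (N₀.inv_mem hfN) _)
    change Pi.mulSingle x _ ∈ N₀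
    convert h₁ using 1
    funext y
    rcases eq_or_ne y x with rfl | hy
    · simp [mul_assoc]
    · simp [hy]
  have hle : alternatingGroup Y ≤ K :=
    Equiv.Perm.alternatingGroup_le_of_normal (by simpa using hY)
      (K.nontrivial_iff_exists_ne_one.mpr ⟨_, hmem, hτ⟩)
  rw [Subgroup.map_le_iff_le_comap, Subgroup.pi_le_iff]
  rintro y _ ⟨σ, hσ, rfl⟩
  obtain ⟨g, rfl⟩ := MulAction.exists_smul_eq G x y
  change SemidirectProduct.inl (Pi.mulSingle (MulAction.toPermHom G X g x) σ) ∈ N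
  rw [← inr_mul_inl_mulSingle_mul_inv]
  exact hN.conj_mem _ (hle hσ) _

/-- The direct power of a normal subgroup is normal in the wreath product. -/
theorem map_inl_pi_normal {H X G : Type*} [Group H] [Group G] (ρ : G →* Equiv.Perm X)
    (A : Subgroup H) [hA : A.Normal] :
    (Subgroup.map (SemidirectProduct.inl : (X → H) →* Wr H ρ)
      (Subgroup.pi Set.univ fun _ : X => A)).Normal := by
  constructor
  rintro _ ⟨f, hf, rfl⟩ n
  refine ⟨n.left * wrAction H ρ n.right f * n.left⁻¹, fun x _ => ?_, ?_⟩
  · exact hA.conj_mem _ (hf ((ρ n.right)⁻¹ x) trivial) _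
  · ext1 <;> simp [mul_assoc]

theorem stmt_1 {Y X G : Type*} [Fintype Y] [DecidableEq Y] [Fintype X] [Nonempty X] [Group G]
    [MulAction G X] [FaithfulSMul G X] [MulAction.IsPretransitive G X]
    (hY : 5 ≤ Fintype.card Y) (hG : 2 ≤ d G)
    (B : Subgroup (Wr (Equiv.Perm Y) (MulAction.toPermHom G X)))
    (hB : B = Subgroup.map SemidirectProduct.inl
      (Subgroup.pi Set.univ fun _ : X => alternatingGroup Y)) :
    B ≠ ⊥ ∧ B.Normal ∧
      ∀ N : Subgroup (Wr (Equiv.Perm Y) (MulAction.toPermHom G X)),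
        N.Normal → N ≠ ⊥ → B ≤ N := by
  subst hB
  refine ⟨?_, map_inl_pi_normal _ _, fun N hN hN' => map_inl_pi_alternatingGroup_le hY hN hN'⟩
  have := alternatingGroup.isSimpleGroup (α := Y) (by simpa using hY)
  obtain ⟨σ, hσ⟩ := exists_ne (1 : alternatingGroup Y)
  rw [Ne, Subgroup.map_eq_bot_iff_of_injective _ SemidirectProduct.inl_injective]
  intro h
  have hmem : (fun _ => σ : X → Equiv.Perm Y) ∈
      Subgroup.pi Set.univ fun _ : X => alternatingGroup Y := fun _ _ => σ.2
  rw [h, Subgroup.mem_bot] at hmem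
  exact hσ (Subtype.ext (congrFun hmem (Classical.arbitrary X)))
end

section
/- Let Δ₁, Δ₂, Δ₃ be finite sets each of cardinality at least 2. Then d((Sym(Δ₁) × Sym(Δ₂)) ≀_{Δ₃} Sym(Δ₃)) = 3, where Sym(Δ₃) acts on the index set Δ₃ by its natural action. -/
open Equiv Equiv.Perm SemidirectProduct

theorem Subgroup.mem_and_mem_of_commute_of_mul_mem {G : Type*} [Group G] (N : Subgroup G)
    {a b : G} (hab : Commute a b) {r : ℕ} (hr : Odd r) (ha : a ^ 2 = 1) (hb : b ^ r = 1)
    (h : a * b ∈ N) : a ∈ N ∧ b ∈ N := by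
  have key : a ∈ N := by
    have h' := N.pow_mem h r
    obtain ⟨s, rfl⟩ := hr
    rwa [hab.mul_pow, hb, mul_one, pow_succ, pow_mul, ha, one_pow, one_mul] at h'
  exact ⟨key, (N.mul_mem_cancel_left key).1 h⟩

/-- A finite symmetric group is generated by a transposition and an element of odd order. -/
theorem Equiv.Perm.exists_closure_swap_odd_pow_eq_one {α : Type*} [Fintype α] [DecidableEq α]
    (h : 2 ≤ Fintype.card α) :
    ∃ (a b : α) (c : Perm α) (r : ℕ), a ≠ b ∧ Odd r ∧ c ^ r = 1 ∧
      Subgroup.closure {swap a b, c} = ⊤ := by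
  obtain ⟨a, b, l, hl⟩ : ∃ a b l, (Finset.univ : Finset α).toList = a :: b :: l := by
    have hlen : 2 ≤ (Finset.univ : Finset α).toList.length := by simpa using h
    match hm : (Finset.univ : Finset α).toList with
    | [] => simp [hm] at hlen
    | [_] => simp [hm] at hlen
    | a :: b :: l => exact ⟨a, b, l, rfl⟩
  have hnd : (a :: b :: l).Nodup := hl ▸ Finset.nodup_toList _
  have hsupp : (a :: b :: l).formPerm.support = Finset.univ := by
    rw [List.support_formPerm_of_nodup _ hnd (by simp), ← hl, Finset.toList_toFinset]
  have hgen := closure_cycle_adjacent_swap (List.isCycle_formPerm hnd (by simp)) hsupp a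
  rw [List.formPerm_apply_head _ _ _ hnd] at hgen
  have hab : a ≠ b := by
    rintro rfl
    simp at hnd
  rcases Nat.even_or_odd (a :: b :: l).length with he | ho
  · refine ⟨a, b, (b :: l).formPerm, (b :: l).length, hab, ?_,
      List.formPerm_pow_length_eq_one_of_nodup _ hnd.of_cons, ?_⟩
    · rw [List.length_cons, Nat.even_add_one, Nat.not_even_iff_odd] at he
      exact he
    · rw [eq_top_iff, ← hgen, Subgroup.closure_le, List.formPerm_cons_cons]
      have h1 : swap a b ∈ Subgroup.closure {swap a b, (b :: l).formPerm} :=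
        Subgroup.subset_closure (by simp)
      have h2 : (b :: l).formPerm ∈ Subgroup.closure {swap a b, (b :: l).formPerm} :=
        Subgroup.subset_closure (by simp)
      rintro x (rfl | rfl)
      · exact mul_mem h1 h2
      · exact h1
  · exact ⟨a, b, _, _, hab, ho, List.formPerm_pow_length_eq_one_of_nodup _ hnd,
      by rwa [Set.pair_comm]⟩

/-- A subgroup of a finite symmetric group is everything as soon as it contains the transpositions
of consecutive points along a full cycle, except possibly one. -/
theorem Equiv.Perm.eq_top_of_swap_pow_mem {α : Type*} [Fintype α] [DecidableEq α]
    {σ : Perm α} (hσ : σ.IsCycleOn (Finset.univ : Finset α)) (p : α) (N : Subgroup (Perm α))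
    (h : ∀ i, i + 1 < Fintype.card α → swap ((σ ^ i) p) ((σ ^ (i + 1)) p) ∈ N) : N = ⊤ := by
  have h1 : ∀ i, i < Fintype.card α → swap p ((σ ^ i) p) ∈ N := by
    intro i
    induction i with
    | zero => intro _; rw [pow_zero, one_apply, swap_self]; exact N.one_mem
    | succ i ih =>
      intro hi
      exact SubmonoidClass.swap_mem_trans N (ih (by omega)) (h i hi)
  have h2 : ∀ b, swap p b ∈ N := by
    intro b
    obtain ⟨n, hn, rfl⟩ := hσ.exists_pow_eq (Finset.mem_univ p) (Finset.mem_univ b)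
    exact h1 n hn
  rw [eq_top_iff, ← closure_isSwap, Subgroup.closure_le]
  rintro _ ⟨a, b, -, rfl⟩
  exact SubmonoidClass.swap_mem_trans N (swap_comm p a ▸ h2 a) (h2 b)

/-- If a permutation group is generated by a transposition and another element `c`, then a subgroup
containing the transposition and normalized by `c` is everything. -/
theorem Equiv.Perm.eq_top_of_swap_mem_of_mem_normalizer {α : Type*} [Finite α] [DecidableEq α]
    {a b : α} (hab : a ≠ b) {c : Perm α} (hgen : Subgroup.closure {swap a b, c} = ⊤)
    {L : Subgroup (Perm α)} (hs : swap a b ∈ L) (hc : c ∈ Subgroup.normalizer (L : Set (Perm α))) :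
    L = ⊤ := by
  have hL : L.Normal := by
    rw [← Subgroup.normalizer_eq_top_iff, eq_top_iff, ← hgen, Subgroup.closure_le]
    rintro x (rfl | rfl)
    · exact Subgroup.le_normalizer hs
    · exact hc
  rw [eq_top_iff, ← closure_isSwap, Subgroup.closure_le]
  rintro _ ⟨x, y, hxy, rfl⟩
  obtain ⟨g, hg⟩ := isConj_iff.1 (isConj_swap hab hxy)
  exact hg ▸ hL.conj_mem _ hs g

section Wreath

variable {H X G : Type*} [Group H] [Group G]

theorem wrAction_apply (ρ : G →* Perm X) (g : G) (f : X → H) (x : X) :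
    wrAction H ρ g f x = f ((ρ g)⁻¹ x) := rfl

theorem wrAction_mulSingle [DecidableEq X] (ρ : G →* Perm X) (g : G) (p : X) (h : H) :
    wrAction H ρ g (Pi.mulSingle p h) = Pi.mulSingle (ρ g p) h := by
  funext x
  simp only [wrAction_apply, Pi.mulSingle_apply, Perm.inv_eq_iff_eq]

theorem commute_inl_inr {ρ : G →* Perm X} {f : X → H} {g : G} (h : wrAction H ρ g f = f) :
    Commute (inl f : Wr H ρ) (inr g) := by
  have h' := inl_aut (φ := wrAction H ρ) g f
  rw [h, map_inv, eq_mul_inv_iff_mul_eq] at h'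
  exact h'

theorem Wr.eq_top_of_inr_mem_of_inl_mulSingle_mem [Finite X] [DecidableEq X]
    (N : Subgroup (Wr H (MonoidHom.id (Perm X)))) (p : X)
    (hr : ∀ g, (inr g : Wr H (MonoidHom.id (Perm X))) ∈ N)
    (hl : ∀ h, (inl (Pi.mulSingle p h) : Wr H (MonoidHom.id (Perm X))) ∈ N) : N = ⊤ := by
  rw [eq_top_iff]
  intro w _
  rw [← inl_left_mul_inr_right w]
  refine mul_mem ?_ (hr _)
  refine Subgroup.pi_mem_of_mulSingle_mem (H := N.comap inl) w.left fun i => ?_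
  have h := inl_aut (φ := wrAction H (MonoidHom.id (Perm X))) (swap p i)
    (Pi.mulSingle p (w.left i))
  rw [wrAction_mulSingle, MonoidHom.id_apply, swap_apply_left] at h
  rw [Subgroup.mem_comap, h]
  exact mul_mem (mul_mem (hr _) (hl _)) (hr _)

/-- A twisted full cycle, with the twist at a single point, and an adjacent transposition generate
the top group of the wreath product. -/
theorem Wr.inr_mem_of_twisted_cycle_mem [Fintype X] [DecidableEq X]
    {σ : Perm X} (hσ : σ.IsCycleOn (Finset.univ : Finset X)) (p : X) (u : H)
    {N : Subgroup (Wr H (MonoidHom.id (Perm X)))}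
    (hx : inl (Pi.mulSingle p u) * inr σ ∈ N) (hy : inr (swap p (σ p)) ∈ N) (g : Perm X) :
    inr g ∈ N := by
  suffices h : N.comap inr = ⊤ by
    have hg : g ∈ N.comap inr := h ▸ Subgroup.mem_top g
    exact hg
  refine eq_top_of_swap_pow_mem hσ p _ fun i => ?_
  induction i with
  | zero => intro _; simpa using hy
  | succ i ih =>
    intro hi
    have h := ih (by omega)
    rw [Subgroup.mem_comap] at h ⊢
    have hne : ∀ j, 0 < j → j < Fintype.card X → (σ ^ j) p ≠ p := fun j hj hj' hp =>
      absurd (Nat.le_of_dvd hj ((hσ.pow_apply_eq (Finset.mem_univ p)).1 hp)) (not_le.2 hj')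
    have hconj := mul_mem (mul_mem hx h) (inv_mem hx)
    have hcomm : Commute (inl (Pi.mulSingle p u) : Wr H (MonoidHom.id (Perm X)))
        (inr (swap ((σ ^ (i + 1)) p) ((σ ^ (i + 1 + 1)) p))) := by
      apply commute_inl_inr
      rw [wrAction_mulSingle, MonoidHom.id_apply, swap_apply_of_ne_of_ne
        (hne _ (by omega) (by omega)).symm (hne _ (by omega) hi).symm]
    have hswap : swap ((σ ^ (i + 1)) p) ((σ ^ (i + 1 + 1)) p)
        = σ * swap ((σ ^ i) p) ((σ ^ (i + 1)) p) * σ⁻¹ := by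
      rw [← swap_apply_apply, pow_succ' σ i, pow_succ' σ (i + 1), pow_succ' σ i]
      rfl
    convert hconj using 1
    rw [eq_mul_inv_iff_mul_eq, ← mul_assoc, ← hcomm.eq, hswap]
    simp [mul_assoc]

end Wreath

theorem Wr.closure_triple_eq_top {α β X : Type*} [Finite α] [DecidableEq α] [Finite β]
    [DecidableEq β] [Fintype X] [DecidableEq X]
    {u c : Perm α} {a b : β} {c' : Perm β} {r r' : ℕ} (hab : a ≠ b) (hr : Odd r) (hr' : Odd r')
    (hc : c ^ r = 1) (hc' : c' ^ r' = 1) (hα : Subgroup.closure {u, c} = ⊤)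
    (hβ : Subgroup.closure {swap a b, c'} = ⊤)
    {σ : Perm X} (hσ : σ.IsCycleOn (Finset.univ : Finset X)) (p : X) :
    Subgroup.closure ({inl (Pi.mulSingle p (u, 1)) * inr σ,
      inr (swap p (σ p)) * inl (fun _ => (1, c')),
      inl (Pi.mulSingle p (c, swap a b))} :
        Set (Wr (Perm α × Perm β) (MonoidHom.id (Perm X)))) = ⊤ := by
  set N := Subgroup.closure ({inl (Pi.mulSingle p (u, 1)) * inr σ,
      inr (swap p (σ p)) * inl (fun _ => (1, c')),
      inl (Pi.mulSingle p (c, swap a b))} :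
        Set (Wr (Perm α × Perm β) (MonoidHom.id (Perm X))))
  have hx : inl (Pi.mulSingle p (u, 1)) * inr σ ∈ N := Subgroup.subset_closure (by simp)
  have hy : inr (swap p (σ p)) * inl (fun _ => (1, c')) ∈ N := Subgroup.subset_closure (by simp)
  have hz : inl (Pi.mulSingle p (c, swap a b)) ∈ N := Subgroup.subset_closure (by simp)
  obtain ⟨hτ, hD⟩ := N.mem_and_mem_of_commute_of_mul_mem (commute_inl_inr rfl).symm hr'
    (by rw [← map_pow, sq, swap_mul_self, map_one])
    (by
      rw [← map_pow, show ((fun _ => (1, c') : X → Perm α × Perm β)) ^ r' = 1 by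
        funext x; simp [hc'], map_one]) hy
  have hinr := inr_mem_of_twisted_cycle_mem hσ p (u, 1) hx hτ
  have hu := (N.mul_mem_cancel_right (hinr σ)).1 hx
  let K : Subgroup (Perm α × Perm β) :=
    N.comap ((inl : _ →* Wr (Perm α × Perm β) (MonoidHom.id (Perm X))).comp
      (MonoidHom.mulSingle (fun _ : X => Perm α × Perm β) p))
  have hK : ∀ h, h ∈ K ↔ inl (Pi.mulSingle p h) ∈ N := fun h => Iff.rfl
  rw [← hK] at hu hz
  obtain ⟨hs, hcK⟩ := K.mem_and_mem_of_commute_of_mul_mem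
    (a := ((1 : Perm α), swap a b)) (b := (c, (1 : Perm β))) (by ext <;> simp) hr
    (by simp [sq]) (by simp [hc]) (by simpa using hz)
  have hα' : K.comap (MonoidHom.inl _ _) = ⊤ := by
    rw [eq_top_iff, ← hα, Subgroup.closure_le]
    rintro x (rfl | rfl)
    · exact hu
    · exact hcK
  have hβ' : K.comap (MonoidHom.inr _ _) = ⊤ := by
    refine eq_top_of_swap_mem_of_mem_normalizer hab hβ hs ?_
    rw [Subgroup.mem_normalizer_iff]
    intro h
    simp only [Subgroup.mem_comap, MonoidHom.inr_apply, hK]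
    have hconj : (inl (Pi.mulSingle p ((1 : Perm α), c' * h * c'⁻¹)) :
        Wr (Perm α × Perm β) (MonoidHom.id (Perm X)))
        = inl (fun _ => (1, c')) * inl (Pi.mulSingle p (1, h)) * (inl (fun _ => (1, c')))⁻¹ := by
      rw [← map_inv, ← map_mul, ← map_mul]
      congr 1
      funext x
      by_cases hxp : x = p
      · subst hxp; simp
      · simp [hxp, Prod.one_eq_mk]
    rw [hconj, N.mul_mem_cancel_right (inv_mem hD), N.mul_mem_cancel_left hD]
  refine eq_top_of_inr_mem_of_inl_mulSingle_mem N p hinr fun h => ?_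
  have h1 : h.1 ∈ K.comap (MonoidHom.inl _ _) := hα' ▸ Subgroup.mem_top _
  have h2 : h.2 ∈ K.comap (MonoidHom.inr _ _) := hβ' ▸ Subgroup.mem_top _
  have h3 := mul_mem (Subgroup.mem_comap.1 h1) (Subgroup.mem_comap.1 h2)
  rwa [MonoidHom.inl_apply, MonoidHom.inr_apply, Prod.mk_mul_mk, mul_one, one_mul, hK] at h3

/-- The three sign characters of `(Sym(α) × Sym(β)) ≀ Sym(X)`. -/
def Wr.signs (α β X : Type*) [Fintype α] [DecidableEq α] [Fintype β] [DecidableEq β]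
    [Fintype X] [DecidableEq X] :
    Wr (Perm α × Perm β) (MonoidHom.id (Perm X)) →* ℤˣ × ℤˣ × ℤˣ :=
  SemidirectProduct.lift
    { toFun := fun f => (∏ x, sign (f x).1, ∏ x, sign (f x).2, 1)
      map_one' := by simp
      map_mul' := fun f g => by simp [Finset.prod_mul_distrib] }
    { toFun := fun g => (1, 1, sign g)
      map_one' := by simp
      map_mul' := fun f g => by simp }
    (fun g => by
      ext f : 1
      simp only [MonoidHom.comp_apply, MulEquiv.toMonoidHom_eq_coe, MonoidHom.coe_coe,
        MulAut.conj_apply, MonoidHom.coe_mk, OneHom.coe_mk, wrAction_apply, MonoidHom.id_apply,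
        mul_inv_cancel_comm]
      exact Prod.ext (Equiv.prod_comp g⁻¹ fun x => sign (f x).1)
        (Prod.ext (Equiv.prod_comp g⁻¹ fun x => sign (f x).2) rfl))

theorem Wr.signs_surjective (α β X : Type*) [Fintype α] [DecidableEq α] [Fintype β]
    [DecidableEq β] [Fintype X] [DecidableEq X] [Nontrivial α] [Nontrivial β] [Nontrivial X] :
    Function.Surjective (Wr.signs α β X) := by
  rintro ⟨e₁, e₂, e₃⟩
  obtain ⟨s₁, rfl⟩ := sign_surjective α e₁
  obtain ⟨s₂, rfl⟩ := sign_surjective β e₂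
  obtain ⟨s₃, rfl⟩ := sign_surjective X e₃
  obtain ⟨p⟩ : Nonempty X := inferInstance
  refine ⟨inl (Pi.mulSingle p (s₁, s₂)) * inr s₃, ?_⟩
  rw [map_mul, Wr.signs, lift_inl, lift_inr]
  have h1 : ∀ x, sign ((Pi.mulSingle p (s₁, s₂) : X → Perm α × Perm β) x).1
      = if x = p then sign s₁ else 1 := fun x => by
    by_cases hx : x = p <;> simp [hx]
  have h2 : ∀ x, sign ((Pi.mulSingle p (s₁, s₂) : X → Perm α × Perm β) x).2
      = if x = p then sign s₂ else 1 := fun x => by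
    by_cases hx : x = p <;> simp [hx]
  simp [h1, h2]

theorem three_le_card_of_closure_eq_top {G : Type*} [Group G] (φ : G →* ℤˣ × ℤˣ × ℤˣ)
    (hφ : Function.Surjective φ) (S : Finset G) (hS : Subgroup.closure (S : Set G) = ⊤) :
    3 ≤ S.card := by
  by_contra! hlt
  obtain ⟨a, b, hab⟩ : ∃ a b, (S : Set G) ⊆ {a, b} := by
    classical
    have : S.card = 0 ∨ S.card = 1 ∨ S.card = 2 := by omega
    rcases this with h | h | h
    · exact ⟨1, 1, by simp [Finset.card_eq_zero.1 h]⟩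
    · obtain ⟨a, rfl⟩ := Finset.card_eq_one.1 h
      exact ⟨a, a, by simp⟩
    · obtain ⟨a, b, -, rfl⟩ := Finset.card_eq_two.1 h
      exact ⟨a, b, by simp⟩
  have hsep : ∀ x y : ℤˣ × ℤˣ × ℤˣ, ∃ v, v ≠ 1 ∧ v ≠ x ∧ v ≠ y ∧ v ≠ x * y := by decide
  obtain ⟨v, h1, h2, h3, h4⟩ := hsep (φ a) (φ b)
  have hv : v ∈ Subgroup.closure {φ a, φ b} := by
    obtain ⟨g, rfl⟩ := hφ v
    have hg : g ∈ (Subgroup.closure {φ a, φ b}).comap φ := by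
      have hle : Subgroup.closure (S : Set G) ≤ (Subgroup.closure {φ a, φ b}).comap φ := by
        rw [Subgroup.closure_le]
        intro s hs
        have hs' := hab hs
        simp only [Set.mem_insert_iff, Set.mem_singleton_iff] at hs'
        refine Subgroup.subset_closure ?_
        rcases hs' with rfl | rfl <;> simp
      exact hle (hS ▸ Subgroup.mem_top g)
    exact hg
  obtain ⟨m, n, rfl⟩ := Subgroup.mem_closure_pair.1 hv
  have hsq : ∀ x : ℤˣ × ℤˣ × ℤˣ, x * x = 1 := by decide
  have hpow : ∀ (x : ℤˣ × ℤˣ × ℤˣ) (k : ℤ), x ^ k = 1 ∨ x ^ k = x := fun x k => by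
    rcases Int.even_or_odd k with ⟨j, rfl⟩ | ⟨j, rfl⟩
    · left; rw [zpow_add, hsq]
    · right; rw [two_mul, zpow_add_one, zpow_add, hsq, one_mul]
  rcases hpow (φ a) m with h | h <;> rcases hpow (φ b) n with h' | h' <;> simp [h, h'] at *

theorem stmt_2 {Δ₁ Δ₂ Δ₃ : Type*} [Fintype Δ₁] [Fintype Δ₂] [Fintype Δ₃]
    (h1 : 2 ≤ Fintype.card Δ₁) (h2 : 2 ≤ Fintype.card Δ₂) (h3 : 2 ≤ Fintype.card Δ₃) :
    d (Wr (Equiv.Perm Δ₁ × Equiv.Perm Δ₂) (MonoidHom.id (Equiv.Perm Δ₃))) = 3 := by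
  classical
  have : Nontrivial Δ₁ := Fintype.one_lt_card_iff_nontrivial.1 h1
  have : Nontrivial Δ₂ := Fintype.one_lt_card_iff_nontrivial.1 h2
  have : Nontrivial Δ₃ := Fintype.one_lt_card_iff_nontrivial.1 h3
  obtain ⟨a, b, c, r, -, hr, hc, hgen⟩ := exists_closure_swap_odd_pow_eq_one h1
  obtain ⟨a', b', c', r', hab', hr', hc', hgen'⟩ := exists_closure_swap_odd_pow_eq_one h2
  obtain ⟨σ, hσ, -⟩ := Finset.exists_cycleOn (Finset.univ : Finset Δ₃)
  obtain ⟨p⟩ : Nonempty Δ₃ := inferInstance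
  have htop := Wr.closure_triple_eq_top hab' hr hr' hc hc' hgen hgen' hσ p
  have hlow := three_le_card_of_closure_eq_top _ (Wr.signs_surjective Δ₁ Δ₂ Δ₃)
  have hmem : 3 ∈ {n | ∃ S : Finset (Wr (Perm Δ₁ × Perm Δ₂) (MonoidHom.id (Perm Δ₃))),
      S.card = n ∧ Subgroup.closure (S : Set (Wr (Perm Δ₁ × Perm Δ₂) (MonoidHom.id (Perm Δ₃)))) = ⊤} := by
    have htop' := htop
    rw [← Finset.coe_singleton, ← Finset.coe_insert, ← Finset.coe_insert] at htop'
    exact ⟨_, le_antisymm Finset.card_le_three (hlow _ htop'), htop'⟩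
  refine le_antisymm (Nat.sInf_le hmem) ?_
  obtain ⟨S, hS, hS'⟩ := Nat.sInf_mem ⟨3, hmem⟩
  exact (hlow S hS').trans hS.le
end

section
/- Let I be a finite index set with |I| ≥ 2, and for each i ∈ I let Δᵢ be a finite set with |Δᵢ| ≥ 2. Then the minimal number of generators of the direct product ∏_{i ∈ I} Sym(Δᵢ) equals |I|. -/
theorem card_le_of_closure_eq_top {I : Type*} [Fintype I] (Δ : I → Type*) [∀ i, Fintype (Δ i)]
    (hΔ : ∀ i, 2 ≤ Fintype.card (Δ i)) (S : Finset (∀ i, Equiv.Perm (Δ i)))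
    (hS : Subgroup.closure (S : Set (∀ i, Equiv.Perm (Δ i))) = ⊤) :
    Fintype.card I ≤ S.card := by
  classical
  let χ : Finset I → (∀ i, Equiv.Perm (Δ i)) →* ℤˣ := fun T =>
    ∏ i ∈ T, Equiv.Perm.sign.comp (Pi.evalMonoidHom (fun i => Equiv.Perm (Δ i)) i)
  have hinj : Function.Injective (fun (T : Finset I) (s : S) => χ T s) := by
    intro T T' h
    have hχ : χ T = χ T' :=
      MonoidHom.eq_of_eqOn_dense hS fun s hs => congrFun h ⟨s, hs⟩
    have key (U : Finset I) (i : I) (x y : Δ i) (hxy : x ≠ y) :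
        χ U (Pi.mulSingle i (Equiv.swap x y)) = if i ∈ U then -1 else 1 := by
      simp only [χ, MonoidHom.finsetProd_apply, MonoidHom.comp_apply, Pi.evalMonoidHom_apply]
      have (j : I) : Equiv.Perm.sign ((Pi.mulSingle i (Equiv.swap x y) : ∀ i, Equiv.Perm (Δ i)) j) =
          if i = j then -1 else 1 := by
        rcases eq_or_ne i j with rfl | hij
        · simp [hxy]
        · simp [hij]
      simp [this]
    ext i
    obtain ⟨x, y, hxy⟩ := Fintype.one_lt_card_iff.mp (hΔ i)
    have h1 := key T i x y hxy
    rw [hχ, key T' i x y hxy] at h1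
    by_cases hT : i ∈ T <;> by_cases hT' : i ∈ T' <;> simp_all
  have := Fintype.card_le_of_injective _ hinj
  simp only [Fintype.card_finset, Fintype.card_fun, Fintype.card_units_int,
    Fintype.card_coe] at this
  exact (Nat.pow_le_pow_iff_right (by norm_num)).mp this

theorem subgroup_perm_eq_top_of_swap_mem {α : Type*} [Finite α] [DecidableEq α]
    (H : Subgroup (Equiv.Perm α)) (a : α) (h : ∀ x, Equiv.swap a x ∈ H) : H = ⊤ := by
  rw [eq_top_iff, ← Equiv.Perm.closure_isSwap, Subgroup.closure_le]
  rintro _ ⟨x, y, -, rfl⟩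
  exact SubmonoidClass.swap_mem_trans _ (Equiv.swap_comm a x ▸ h x) (h y)

theorem exists_involution_odd_order_closure_eq_top (α : Type*) [Fintype α]
    (hα : 2 ≤ Fintype.card α) :
    ∃ (t c : Equiv.Perm α) (m : ℕ), t ^ 2 = 1 ∧ Odd m ∧ c ^ m = 1 ∧
      Subgroup.closure {t, c} = ⊤ := by
  classical
  obtain ⟨a, b, hab⟩ := Fintype.one_lt_card_iff.mp hα
  have hpow (s : Finset α) (c : Equiv.Perm α) (hc : c.IsCycleOn s) (hs : c.support ⊆ s) :
      c ^ s.card = 1 := by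
    ext x
    by_cases hx : x ∈ s
    · exact hc.pow_card_apply hx
    · exact Equiv.Perm.pow_apply_eq_self_of_apply_eq_self
        (Equiv.Perm.notMem_support.mp fun h => hx (hs h)) _
  rcases Nat.even_or_odd (Fintype.card α) with hn | hn
  · obtain ⟨c, hc, hs⟩ := (Finset.univ.erase a).exists_cycleOn
    refine ⟨Equiv.swap a b, c, _, by simp [sq], ?_, hpow _ c hc hs, ?_⟩
    · rw [Finset.card_erase_of_mem (Finset.mem_univ a), Finset.card_univ]
      exact Nat.Even.sub_odd (by omega) hn odd_one
    · refine subgroup_perm_eq_top_of_swap_mem _ a fun x => ?_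
      rcases eq_or_ne x a with rfl | hx
      · rw [Equiv.swap_self]
        exact one_mem _
      · obtain ⟨k, -, rfl⟩ := hc.exists_pow_eq (a := b) (b := x) (by simp [hab.symm]) (by simp [hx])
        have hca : (c ^ k) a = a := Equiv.Perm.pow_apply_eq_self_of_apply_eq_self
          (Equiv.Perm.notMem_support.mp fun h => by simpa using hs h) _
        have hck : c ^ k ∈ Subgroup.closure {Equiv.swap a b, c} :=
          pow_mem (Subgroup.subset_closure (by simp)) k
        have := Equiv.swap_apply_apply (c ^ k) a b
        rw [hca] at this
        rw [this]
        exact mul_mem (mul_mem hck (Subgroup.subset_closure (by simp))) (inv_mem hck)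
  · obtain ⟨c, hc, hs⟩ := (Finset.univ : Finset α).exists_cycleOn
    refine ⟨Equiv.swap a (c a), c, _, by simp [sq], hn, hpow _ c hc hs, ?_⟩
    have hcm : c ∈ Subgroup.closure {Equiv.swap a (c a), c} := Subgroup.subset_closure (by simp)
    refine subgroup_perm_eq_top_of_swap_mem _ a fun x => ?_
    obtain ⟨k, -, rfl⟩ := hc.exists_pow_eq (Finset.mem_univ a) (Finset.mem_univ x)
    clear hs
    induction k with
    | zero =>
      rw [pow_zero, Equiv.Perm.one_apply, Equiv.swap_self]
      exact one_mem _
    | succ k ih =>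
      refine SubmonoidClass.swap_mem_trans _ ih ?_
      rw [pow_succ, Equiv.Perm.mul_apply, Equiv.swap_apply_apply]
      exact mul_mem (mul_mem (pow_mem hcm k) (Subgroup.subset_closure (by simp)))
        (inv_mem (pow_mem hcm k))

theorem exists_closure_range_eq_top {I : Type*} [Fintype I] (hI : 2 ≤ Fintype.card I)
    (G : I → Type*) [∀ i, Group (G i)]
    (hG : ∀ i, ∃ (t c : G i) (m : ℕ), t ^ 2 = 1 ∧ Odd m ∧ c ^ m = 1 ∧
      Subgroup.closure {t, c} = ⊤) :
    ∃ g : I → ∀ i, G i, Subgroup.closure (Set.range g) = ⊤ := by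
  classical
  choose t c m ht hm hc htc using hG
  obtain ⟨f, hf, -⟩ := (Finset.univ : Finset I).exists_cycleOn
  have hne (i : I) : i ≠ f i := (hf.apply_ne
    (by
      rw [Finset.coe_univ, Set.nontrivial_univ_iff]
      exact Fintype.one_lt_card_iff_nontrivial.mp hI)
    (by simp)).symm
  let g : I → ∀ i, G i := fun i => Pi.mulSingle i (t i) * Pi.mulSingle (f i) (c (f i))
  refine ⟨g, ?_⟩
  have hg (i : I) : g i ∈ Subgroup.closure (Set.range g) := Subgroup.subset_closure ⟨i, rfl⟩
  have htm (i : I) : Pi.mulSingle i (t i) ∈ Subgroup.closure (Set.range g) := by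
    have h : g i ^ m (f i) = Pi.mulSingle i (t i) := by
      have hcomm : Commute (Pi.mulSingle i (t i)) (Pi.mulSingle (f i) (c (f i))) :=
        Pi.mulSingle_commute (hne i) _ _
      obtain ⟨r, hr⟩ := hm (f i)
      have htr : t i ^ m (f i) = t i := by
        rw [hr, pow_succ, pow_mul, ht, one_pow, one_mul]
      rw [hcomm.mul_pow, ← Pi.mulSingle_pow, ← Pi.mulSingle_pow, hc, htr, Pi.mulSingle_one, mul_one]
    exact h ▸ pow_mem (hg i) _
  have hcm (i : I) : Pi.mulSingle i (c i) ∈ Subgroup.closure (Set.range g) := by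
    obtain ⟨j, rfl⟩ := f.surjective i
    exact (Subgroup.mul_mem_cancel_left _ (htm j)).mp (hg j)
  refine eq_top_iff.mpr fun x _ => Subgroup.pi_mem_of_mulSingle_mem x fun i => ?_
  have hle : Subgroup.closure {t i, c i} ≤
      (Subgroup.closure (Set.range g)).comap (MonoidHom.mulSingle G i) := by
    rw [Subgroup.closure_le]
    rintro _ (rfl | rfl)
    · exact htm i
    · exact hcm i
  exact hle (htc i ▸ Subgroup.mem_top (x i))

theorem stmt_8 {I : Type*} [Fintype I] (Δ : I → Type*) [∀ i, Fintype (Δ i)]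
    (hI : 2 ≤ Fintype.card I) (hΔ : ∀ i, 2 ≤ Fintype.card (Δ i)) :
    d (∀ i, Equiv.Perm (Δ i)) = Fintype.card I := by
  classical
  obtain ⟨g, hg⟩ := exists_closure_range_eq_top hI (fun i => Equiv.Perm (Δ i))
    fun i => exists_involution_odd_order_closure_eq_top (Δ i) (hΔ i)
  have hmem : (Finset.univ.image g).card ∈ {n | ∃ S : Finset (∀ i, Equiv.Perm (Δ i)),
      S.card = n ∧ Subgroup.closure (S : Set (∀ i, Equiv.Perm (Δ i))) = ⊤} :=
    ⟨_, rfl, by simpa using hg⟩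
  refine le_antisymm ((Nat.sInf_le hmem).trans Finset.card_image_le) ?_
  obtain ⟨S, hcard, hS⟩ := Nat.sInf_mem ⟨_, hmem⟩
  exact (card_le_of_closure_eq_top Δ hΔ S hS).trans_eq hcard
end

section
/- Let Δ₂, Δ₃ be finite sets each of cardinality at least 2. Then d(Sym(Δ₂) ≀_{Δ₃} Sym(Δ₃)) = 2, where Sym(Δ₃) acts on the index set Δ₃ by its natural action. -/
namespace Subgroup

variable {G : Type*} [Group G]

theorem mul_comm_of_closure_eq_top {S : Finset G} (hS : S.card ≤ 1)
    (h : closure (S : Set G) = ⊤) (x y : G) : x * y = y * x := by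
  obtain ⟨a, ha⟩ := Finset.card_le_one_iff_subset_singleton.1 hS
  have key (g : G) : ∃ n : ℤ, a ^ n = g := by
    rw [← mem_closure_singleton]
    have hg : g ∈ closure (S : Set G) := h ▸ mem_top g
    exact closure_mono (by exact_mod_cast ha) hg
  obtain ⟨m, rfl⟩ := key x
  obtain ⟨n, rfl⟩ := key y
  exact zpow_mul_comm a m n

theorem mem_and_mem_of_commute_of_odd {H : Subgroup G} {a b : G} (hab : Commute a b) {k : ℕ}
    (hk : Odd k) (ha : a ^ k = 1) (hb : b ^ 2 = 1) (h : a * b ∈ H) : a ∈ H ∧ b ∈ H := by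
  obtain ⟨j, rfl⟩ := hk
  have hbH : b ∈ H := by
    have h' := H.pow_mem h (2 * j + 1)
    rwa [hab.mul_pow, ha, one_mul, pow_succ, pow_mul, hb, one_pow, one_mul] at h'
  exact ⟨(H.mul_mem_cancel_right hbH).1 h, hbH⟩

end Subgroup

theorem d_eq_two_of_closure_pair {G : Type*} [Group G] {a b x y : G} (hab : a * b ≠ b * a)
    (h : Subgroup.closure {x, y} = ⊤) : d G = 2 := by
  classical
  have lower (S : Finset G) (hS : Subgroup.closure (S : Set G) = ⊤) : 2 ≤ S.card := by
    by_contra hlt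
    exact hab (Subgroup.mul_comm_of_closure_eq_top (by omega) hS a b)
  have hxy : Subgroup.closure (({x, y} : Finset G) : Set G) = ⊤ := by simpa using h
  refine le_antisymm (Nat.sInf_le ⟨{x, y}, le_antisymm Finset.card_le_two (lower _ hxy), hxy⟩)
    (le_csInf ⟨_, _, rfl, hxy⟩ ?_)
  rintro _ ⟨S, rfl, hS⟩
  exact lower S hS

namespace Equiv.Perm

open List

variable {α : Type*} [Fintype α]

theorem exists_nodup_list_forall_mem (h : 2 ≤ Fintype.card α) :
    ∃ (x y : α) (l : List α), (x :: y :: l).Nodup ∧ ∀ a, a ∈ x :: y :: l := by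
  have hlen : (Finset.univ : Finset α).toList.length = Fintype.card α := by simp
  have hnd := (Finset.univ : Finset α).nodup_toList
  have hmem (a : α) : a ∈ (Finset.univ : Finset α).toList := by simp
  match h' : (Finset.univ : Finset α).toList with
  | [] => rw [h', length_nil] at hlen; omega
  | [_] => rw [h', length_singleton] at hlen; omega
  | x :: y :: l => exact ⟨x, y, l, h' ▸ hnd, fun a => h' ▸ hmem a⟩

variable [DecidableEq α]

theorem closure_formPerm_swap_eq_top {x y : α} {l : List α} (hl : (x :: y :: l).Nodup)
    (hmem : ∀ a, a ∈ x :: y :: l) :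
    Subgroup.closure {formPerm (x :: y :: l), swap x y} = ⊤ := by
  have hsupp : (formPerm (x :: y :: l)).support = Finset.univ := by
    rw [support_formPerm_of_nodup _ hl (by simp)]
    ext a
    simpa using hmem a
  have h := closure_cycle_adjacent_swap (isCycle_formPerm hl (by simp)) hsupp x
  rwa [formPerm_apply_head x y l hl] at h

/-- A finite symmetric group is generated by an involution and an element of odd order. -/
theorem exists_involution_odd_generators (h : 2 ≤ Fintype.card α) :
    ∃ (s c : Perm α) (k : ℕ), s ^ 2 = 1 ∧ Odd k ∧ c ^ k = 1 ∧
      Subgroup.closure {s, c} = ⊤ := by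
  obtain ⟨x, y, l, hl, hmem⟩ := exists_nodup_list_forall_mem h
  have hs : swap x y ^ 2 = 1 := by rw [sq, swap_mul_self]
  have htop := closure_formPerm_swap_eq_top hl hmem
  rcases Nat.even_or_odd (x :: y :: l).length with he | ho
  · refine ⟨swap x y, formPerm (y :: l), (y :: l).length, hs, ?_,
      formPerm_pow_length_eq_one_of_nodup _ hl.of_cons, ?_⟩
    · rw [length_cons, Nat.even_add_one, Nat.not_even_iff_odd] at he
      exact he
    · rw [eq_top_iff, ← htop, Subgroup.closure_le]
      have h1 : swap x y ∈ Subgroup.closure {swap x y, formPerm (y :: l)} :=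
        Subgroup.subset_closure (by simp)
      have h2 : formPerm (y :: l) ∈ Subgroup.closure {swap x y, formPerm (y :: l)} :=
        Subgroup.subset_closure (by simp)
      rintro _ (rfl | rfl)
      · rw [formPerm_cons_cons]
        exact mul_mem h1 h2
      · exact h1
  · exact ⟨swap x y, formPerm (x :: y :: l), _, hs, ho,
      formPerm_pow_length_eq_one_of_nodup _ hl, by rwa [Set.pair_comm]⟩

theorem IsCycle.exists_pow_lt_orderOf_eq_iff {σ : Perm α} (hσ : σ.IsCycle) {p : α}
    (hp : p ∈ σ.support) (z : α) : (∃ i < orderOf σ, (σ ^ i) p = z) ↔ z ∈ σ.support := by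
  constructor
  · rintro ⟨i, -, rfl⟩
    exact pow_apply_mem_support.2 hp
  · intro hz
    obtain ⟨i, hi⟩ := hσ.exists_pow_eq (mem_support.1 hp) (mem_support.1 hz)
    exact ⟨i % orderOf σ, Nat.mod_lt _ (orderOf_pos σ), by rw [pow_mod_orderOf, hi]⟩

end Equiv.Perm

namespace Wr

open SemidirectProduct Equiv Equiv.Perm

variable {K X : Type*} [Group K] [DecidableEq X]

theorem wrAction_mulSingle (σ : Perm X) (p : X) (a : K) :
    wrAction K (MonoidHom.id (Perm X)) σ (Pi.mulSingle p a) = Pi.mulSingle (σ p) a := by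
  ext z
  change (Pi.mulSingle p a : X → K) (σ⁻¹ z) = _
  by_cases hz : z = σ p
  · subst hz
    simp
  · rw [Pi.mulSingle_eq_of_ne hz, Pi.mulSingle_eq_of_ne]
    rwa [Ne, Perm.inv_eq_iff_eq]

/-- The element of the wreath product supported at the coordinate `p` with value `a`. -/
def single (p : X) (a : K) : Wr K (MonoidHom.id (Perm X)) :=
  inl (Pi.mulSingle p a)

theorem single_pow (p : X) (a : K) (k : ℕ) : single p a ^ k = single p (a ^ k) := by
  rw [single, single, ← map_pow, Pi.mulSingle_pow]

theorem inr_mul_single (σ : Perm X) (p : X) (a : K) :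
    inr σ * single p a = single (σ p) a * inr σ := by
  rw [single, single, ← wrAction_mulSingle, inl_aut]
  simp

theorem commute_single (p q : X) (a : K) : Commute (single p a) (single q a) := by
  have h : Commute (Pi.mulSingle p a : X → K) (Pi.mulSingle q a) := by
    by_cases hpq : p = q
    · rw [hpq]
    · exact Pi.mulSingle_commute (f := fun _ => K) hpq a a
  exact h.map inl

theorem commute_single_of_ne {p q : X} (hpq : p ≠ q) (a b : K) :
    Commute (single p a) (single q b) :=
  Commute.map (Pi.mulSingle_commute (f := fun _ => K) hpq a b) inl

theorem single_mul_inr_pow_left (p : X) (s : K) (σ : Perm X) (k : ℕ) (hk : k ≤ orderOf σ)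
    (hσ : ∀ i, (σ ^ i) p = p → σ ^ i = 1) (z : X) [Decidable (∃ i < k, (σ ^ i) p = z)] :
    ((single p s * inr σ) ^ k).left z = if ∃ i < k, (σ ^ i) p = z then s else 1 := by
  classical
  induction k generalizing z with
  | zero => simp
  | succ k ih =>
    have hstep : ((single p s * inr σ) ^ (k + 1)).left z =
        (Pi.mulSingle p s : X → K) z * ((single p s * inr σ) ^ k).left (σ⁻¹ z) := by
      rw [pow_succ', mul_left, single, ← mk_eq_inl_mul_inr]
      rfl
    rw [hstep, ih (by omega)]
    have hshift (i : ℕ) : (σ ^ i) p = σ⁻¹ z ↔ (σ ^ (i + 1)) p = z := by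
      rw [Perm.eq_inv_iff_eq, pow_succ', Perm.mul_apply]
    simp only [hshift]
    by_cases hz : z = p
    · subst hz
      rw [if_neg, if_pos ⟨0, by omega, by simp⟩]
      · simp
      · rintro ⟨i, hi, h⟩
        exact pow_ne_one_of_lt_orderOf (by omega) (by omega) (hσ _ h)
    · rw [Pi.mulSingle_eq_of_ne hz, one_mul]
      congr 1
      refine propext ⟨fun ⟨i, hi, h⟩ => ⟨i + 1, by omega, h⟩, ?_⟩
      rintro ⟨_ | i, hi, h⟩
      · exact absurd h.symm (by simpa using hz)
      · exact ⟨i, by omega, h⟩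

theorem single_mul_inr_pow_orderOf [Fintype X] {σ : Perm X} (hσ : σ.IsCycle) {p : X}
    (hp : p ∈ σ.support) (s : K) :
    (single p s * inr σ) ^ orderOf σ = inl fun z => if z ∈ σ.support then s else 1 := by
  classical
  ext z
  · rw [single_mul_inr_pow_left p s σ _ le_rfl
      (fun i hi => hσ.pow_eq_one_iff.2 ⟨p, mem_support.1 hp, hi⟩)]
    simp only [hσ.exists_pow_lt_orderOf_eq_iff hp, left_inl]
  · rw [right_inl, ← rightHom_eq_right, map_pow, map_mul, rightHom_inr, single, rightHom_inl,
      one_mul, pow_orderOf_eq_one]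

theorem eq_top_of_generators_mem [Finite X] {H : Subgroup (Wr K (MonoidHom.id (Perm X)))}
    {σ τ : Perm X} {s c : K} {p q : X} (hX : Subgroup.closure {σ, τ} = ⊤)
    (hK : Subgroup.closure {s, c} = ⊤) (hσ : inr σ ∈ H) (hτ : inr τ ∈ H)
    (hs : single p s ∈ H) (hc : single q c ∈ H) : H = ⊤ := by
  have hinr (g : Perm X) : inr g ∈ H := by
    have hle : Subgroup.closure {σ, τ} ≤ H.comap inr := by
      rw [Subgroup.closure_le]
      rintro _ (rfl | rfl) <;> assumption
    exact hle (hX ▸ Subgroup.mem_top g)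
  have hmove {x : X} {a : K} (y : X) (h : single x a ∈ H) : single y a ∈ H := by
    have h' := H.mul_mem (hinr (swap x y)) h
    rw [inr_mul_single, swap_apply_left] at h'
    exact (H.mul_mem_cancel_right (hinr _)).1 h'
  have hsingle (x : X) (a : K) : single x a ∈ H := by
    have hle : Subgroup.closure {s, c} ≤
        (H.comap inl).comap (MonoidHom.mulSingle (fun _ => K) x) := by
      rw [Subgroup.closure_le]
      rintro _ (rfl | rfl)
      · exact hmove x hs
      · exact hmove x hc
    exact hle (hK ▸ Subgroup.mem_top a)
  refine (Subgroup.eq_top_iff' H).2 fun w => ?_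
  rw [← inl_left_mul_inr_right w]
  exact H.mul_mem (Subgroup.pi_mem_of_mulSingle_mem (H := H.comap inl) _ fun x => hsingle x _)
    (hinr _)

theorem exists_mul_ne_mul [Nontrivial K] {x y : X} (hxy : x ≠ y) :
    ∃ a b : Wr K (MonoidHom.id (Perm X)), a * b ≠ b * a := by
  obtain ⟨k, hk⟩ := exists_ne (1 : K)
  refine ⟨inr (swap x y), single x k, fun h => ?_⟩
  rw [inr_mul_single, swap_apply_left, mul_left_inj, single, single, inl_inj] at h
  have h' := congrFun h x
  rw [Pi.mulSingle_eq_of_ne hxy, Pi.mulSingle_eq_same] at h'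
  exact hk h'.symm

theorem exists_closure_pair_eq_top [Fintype X] (hX : 2 ≤ Fintype.card X) {s c : K} {k : ℕ}
    (hs : s ^ 2 = 1) (hk : Odd k) (hc : c ^ k = 1) (hK : Subgroup.closure {s, c} = ⊤) :
    ∃ u v : Wr K (MonoidHom.id (Perm X)), Subgroup.closure {u, v} = ⊤ := by
  obtain ⟨x, y, l, hl, hmem⟩ := exists_nodup_list_forall_mem hX
  have hxy : x ≠ y := by rintro rfl; simp at hl
  have hperm := closure_formPerm_swap_eq_top hl hmem
  rcases l with _ | ⟨z, l⟩
  · refine ⟨single y c * single x s, inr (swap x y), ?_⟩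
    set H := Subgroup.closure {single y c * single x s, inr (swap x y)}
    have hu : single y c * single x s ∈ H := Subgroup.subset_closure (by simp)
    have hv : inr (swap x y) ∈ H := Subgroup.subset_closure (by simp)
    obtain ⟨hcH, hsH⟩ := Subgroup.mem_and_mem_of_commute_of_odd
      (commute_single_of_ne hxy.symm c s) hk (by rw [single_pow, hc]; simp [single])
      (by rw [single_pow, hs]; simp [single]) hu
    rw [List.formPerm_pair] at hperm
    exact eq_top_of_generators_mem hperm hK hv hv hsH hcH
  · set σ := List.formPerm (x :: y :: z :: l)
    set ρ := List.formPerm (y :: z :: l)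
    have hσρ : σ = swap x y * ρ := List.formPerm_cons_cons _ _ _
    have hσc : σ.IsCycle := List.isCycle_formPerm hl (by simp)
    have hρc : ρ.IsCycle := List.isCycle_formPerm hl.of_cons (by simp)
    have hσs (a : X) : a ∈ σ.support := by
      rw [List.support_formPerm_of_nodup _ hl (by simp)]
      simpa using hmem a
    have hρs (a : X) : a ∈ ρ.support ↔ a ≠ x := by
      rw [List.support_formPerm_of_nodup _ hl.of_cons (by simp), List.mem_toFinset]
      refine ⟨fun h hax => (List.nodup_cons.1 hl).1 (hax ▸ h), fun h => ?_⟩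
      exact (List.mem_cons.1 (hmem a)).resolve_left h
    have hzx : z ≠ x := by rintro rfl; simp at hl
    have hzy : z ≠ y := by rintro rfl; simp at hl
    have hτz : swap x y z = z := swap_apply_of_ne_of_ne hzx hzy
    refine ⟨single z c * inr (swap x y), single z s * inr σ, ?_⟩
    set H := Subgroup.closure {single z c * inr (swap x y), single z s * inr σ}
    have hu : single z c * inr (swap x y) ∈ H := Subgroup.subset_closure (by simp)
    have hv : single z s * inr σ ∈ H := Subgroup.subset_closure (by simp)
    obtain ⟨hcH, hτH⟩ := Subgroup.mem_and_mem_of_commute_of_odd (a := single z c)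
      (show Commute _ _ by rw [Commute, SemiconjBy, inr_mul_single, hτz]) hk
      (by rw [single_pow, hc]; simp [single])
      (by rw [← map_pow, sq, swap_mul_self, map_one]) hu
    have hρH : single z s * inr ρ ∈ H := by
      have h := H.mul_mem hτH hv
      rwa [← mul_assoc, inr_mul_single, hτz, mul_assoc, ← map_mul, hσρ, ← mul_assoc,
        swap_mul_self, one_mul] at h
    have hxH : single x s ∈ H := by
      have h1 := H.pow_mem hv (orderOf σ)
      have h2 := H.pow_mem hρH (orderOf ρ)
      rw [single_mul_inr_pow_orderOf hσc (hσs z)] at h1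
      rw [single_mul_inr_pow_orderOf hρc ((hρs z).2 hzx)] at h2
      have h := H.mul_mem h1 (H.inv_mem h2)
      rw [← map_inv, ← map_mul] at h
      convert h using 1
      rw [single, inl_inj]
      ext a
      by_cases ha : a = x
      · subst ha
        simp [hσs, hρs]
      · simp [hσs, hρs, ha]
    have hsH (i : ℕ) : single ((σ ^ i) x) s ∈ H := by
      induction i with
      | zero => simpa using hxH
      | succ i ih =>
        have h := H.mul_mem hv ih
        rw [mul_assoc, inr_mul_single, ← mul_assoc, (commute_single z _ s).eq, mul_assoc] at h
        rw [pow_succ', Perm.mul_apply]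
        exact (H.mul_mem_cancel_right hv).1 h
    obtain ⟨i, hi⟩ := hσc.exists_pow_eq (mem_support.1 (hσs x)) (mem_support.1 (hσs z))
    have hσH : inr σ ∈ H := (H.mul_mem_cancel_left (hi ▸ hsH i)).1 hv
    exact eq_top_of_generators_mem hperm hK hσH hτH hxH hcH

end Wr

theorem stmt_9 {Δ₂ Δ₃ : Type*} [Fintype Δ₂] [Fintype Δ₃]
    (h2 : 2 ≤ Fintype.card Δ₂) (h3 : 2 ≤ Fintype.card Δ₃) :
    d (Wr (Equiv.Perm Δ₂) (MonoidHom.id (Equiv.Perm Δ₃))) = 2 := by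
  classical
  have : Nontrivial Δ₂ := Fintype.one_lt_card_iff_nontrivial.1 h2
  have : Nontrivial Δ₃ := Fintype.one_lt_card_iff_nontrivial.1 h3
  obtain ⟨s, c, k, hs, hk, hc, hK⟩ := Equiv.Perm.exists_involution_odd_generators (α := Δ₂) h2
  obtain ⟨u, v, huv⟩ := Wr.exists_closure_pair_eq_top h3 hs hk hc hK
  obtain ⟨x, y, hxy⟩ := exists_pair_ne Δ₃
  obtain ⟨a, b, hab⟩ := Wr.exists_mul_ne_mul (K := Equiv.Perm Δ₂) hxy
  exact d_eq_two_of_closure_pair hab huv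
end
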